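/- Let u be a smooth function on the unit disk D with ‖u‖_{W^{1,1}(D)} + ‖Δu‖_{L¹(D)} < Λ₃. Then the conformal metric e^{2u} g_euc restricted to D_{1/2} can be extended to a complete metric on ℂ whose total absolute Gauss curvature satisfies ‖K‖_{L¹} < C(Λ₃). Moreover, ‖∇u‖_{L^{2,∞}(D_{1/2})} < C(Λ₃). -/

import Mathlib

open MeasureTheory Filter Metric
open scoped Topology ENNReal

noncomputable section

/-- The Laplacian of `u : ℂ → ℝ` (sum of the two pure second derivatives). -/
def lap (u : ℂ → ℝ) (x : ℂ) : ℝ :=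
  iteratedFDeriv ℝ 2 u x ![1, 1] + iteratedFDeriv ℝ 2 u x ![Complex.I, Complex.I]

/-- Gauss curvature of the conformal metric `e^{2u} g_euc`: `K = -e^{-2u} Δu`. -/
def gauss (u : ℂ → ℝ) (x : ℂ) : ℝ := -Real.exp (-(2 * u x)) * lap u x

/-- Area `μ(A, g)` of a set for the metric `g = e^{2u} g_euc`. -/
def confAreaE (u : ℂ → ℝ) (A : Set ℂ) : ℝ≥0∞ :=
  ∫⁻ x in A, ENNReal.ofReal (Real.exp (2 * u x))

/-- Total curvature `∫_A |K(g)| dμ_g` of the metric `g = e^{2u} g_euc`. -/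
def curvIntE (u : ℂ → ℝ) (A : Set ℂ) : ℝ≥0∞ :=
  ∫⁻ x in A, ENNReal.ofReal (|gauss u x| * Real.exp (2 * u x))

/-- `C¹` paths from `x` to `y` staying in `S`. -/
def PathsIn (S : Set ℂ) (x y : ℂ) : Set (ℝ → ℂ) :=
  {γ | γ 0 = x ∧ γ 1 = y ∧ (∀ t ∈ Set.Icc (0:ℝ) 1, γ t ∈ S) ∧ ContDiff ℝ 1 γ}

/-- Length of a path for the metric `e^{2u} g_euc`. -/
def confLen (u : ℂ → ℝ) (γ : ℝ → ℂ) : ℝ :=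
  ∫ t in (0:ℝ)..1, Real.exp (u (γ t)) * ‖deriv γ t‖

/-- Geodesic distance (within `S`) of the conformal metric `e^{2u} g_euc`. -/
def confDist (u : ℂ → ℝ) (S : Set ℂ) (x y : ℂ) : ℝ :=
  sInf (confLen u '' PathsIn S x y)

/-- Metric ball `B_r^g(z)` of the conformal metric (within `S`). -/
def confBall (u : ℂ → ℝ) (S : Set ℂ) (z : ℂ) (r : ℝ) : Set ℂ :=
  {x ∈ S | confDist u S z x < r}

/-- `‖f‖_{L^{2,∞}(Ω)} ≤ C`, i.e. `t·|{|f| > t}|^{1/2} ≤ C` for all `t > 0`. -/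
def wL2Bound (f : ℂ → ℝ) (Ω : Set ℂ) (C : ℝ) : Prop :=
  ∀ t : ℝ, 0 < t → t * (volume {x ∈ Ω | t < |f x|}).toReal ^ ((1:ℝ)/2) ≤ C

/-- The `W^{1,p}(Ω)` norm of a differentiable function (via its classical gradient). -/
def w1pNormE (u : ℂ → ℝ) (Ω : Set ℂ) (p : ℝ) : ℝ≥0∞ :=
  (∫⁻ x in Ω, ENNReal.ofReal (|u x| ^ p)) ^ (1/p)
    + (∫⁻ x in Ω, ENNReal.ofReal (‖fderiv ℝ u x‖ ^ p)) ^ (1/p)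

/-- Real dot product on `ℂ = ℝ²`. -/
def dotC (a b : ℂ) : ℝ := a.re * b.re + a.im * b.im

/-- `V` is the distributional (weak) gradient of `u` on `Ω`. -/
def IsWeakGradOn (Ω : Set ℂ) (u : ℂ → ℝ) (V : ℂ → ℂ) : Prop :=
  ∀ φ : ℂ → ℝ, ContDiff ℝ (⊤ : ℕ∞) φ → HasCompactSupport φ → tsupport φ ⊆ Ω →
    ∀ w : ℂ, ∫ x in Ω, u x * fderiv ℝ φ x w = -∫ x in Ω, dotC (V x) w * φ x

/-- `v k → u` weakly in `W^{1,p}(Ω)`: uniformly bounded `W^{1,p}` norms together with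
convergence, tested against smooth compactly supported functions, of the functions and of
their weak gradients. -/
def WeakW1pLim (Ω : Set ℂ) (p : ℝ) (v : ℕ → ℂ → ℝ) (u : ℂ → ℝ) : Prop :=
  ∃ V : ℕ → ℂ → ℂ,
    (∀ k, IsWeakGradOn Ω (v k) (V k)) ∧
    (∃ C : ℝ, ∀ k, (∫ x in Ω, |v k x| ^ p) ^ (1/p)
        + (∫ x in Ω, ‖V k x‖ ^ p) ^ (1/p) ≤ C) ∧
    (∀ φ : ℂ → ℝ, ContDiff ℝ (⊤ : ℕ∞) φ → HasCompactSupport φ → tsupport φ ⊆ Ω →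
      Tendsto (fun k => ∫ x in Ω, v k x * φ x) atTop (𝓝 (∫ x in Ω, u x * φ x)) ∧
      ∀ w : ℂ, Tendsto (fun k => ∫ x in Ω, dotC (V k x) w * φ x) atTop
        (𝓝 (-∫ x in Ω, u x * fderiv ℝ φ x w)))

/-- Mean value of `φ` on a set. -/
def avgOn (φ : ℂ → ℝ) (A : Set ℂ) : ℝ := (volume A).toReal⁻¹ * ∫ x in A, φ x

/-- Mean oscillation of `φ` on the disk `D_t(x₀)`. -/
def meanOsc (φ : ℂ → ℝ) (x₀ : ℂ) (t : ℝ) : ℝ :=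
  avgOn (fun x => |φ x - avgOn φ (ball x₀ t)|) (ball x₀ t)

/-- The John–Nirenberg radius `ρ(φ, x₀, Ω, λ)`. -/
def jnRad (φ : ℂ → ℝ) (x₀ : ℂ) (Ω : Set ℂ) (lam : ℝ) : ℝ :=
  sSup {r : ℝ | 0 ≤ r ∧ ∀ t : ℝ, 0 < t → t < r → ball x₀ t ⊆ Ω ∧ meanOsc φ x₀ t ≤ lam}

/-- Mean value of `u` along the circle `∂D_r(0)`. -/
def circMean (u : ℂ → ℝ) (r : ℝ) : ℝ :=
  (2 * Real.pi)⁻¹ * ∫ θ in (0:ℝ)..(2 * Real.pi), u ((r : ℂ) * Complex.exp ((θ : ℂ) * Complex.I))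

/-- Completeness of the conformal metric `e^{2v} g_euc` on all of `ℂ`. -/
def ConfComplete (v : ℂ → ℝ) : Prop :=
  ∀ x : ℕ → ℂ,
    (∀ ε : ℝ, 0 < ε → ∃ N : ℕ, ∀ m ≥ N, ∀ n ≥ N, confDist v Set.univ (x m) (x n) < ε) →
    ∃ l : ℂ, Tendsto (fun n => confDist v Set.univ (x n) l) atTop (𝓝 0)

/-- `(D, g_k)` extends to a complete conformal surface with total curvature at most `Λ`. -/
def ExtendsComplete (u : ℂ → ℝ) (Λ : ℝ) : Prop :=
  ∃ v : ℂ → ℝ, ContDiff ℝ (⊤ : ℕ∞) v ∧ Set.EqOn v u (ball (0:ℂ) 1) ∧ ConfComplete v ∧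
    curvIntE v Set.univ ≤ ENNReal.ofReal Λ

/-- Gromov–Hausdorff convergence of `(S, dk k)` to `(S, d)`, phrased through
correspondences of small distortion. -/
def GHTendsto (S : Set ℂ) (dk : ℕ → ℂ → ℂ → ℝ) (d : ℂ → ℂ → ℝ) : Prop :=
  ∀ ε : ℝ, 0 < ε → ∀ᶠ k in atTop, ∃ R : Set (ℂ × ℂ),
    (∀ p ∈ R, p.1 ∈ S ∧ p.2 ∈ S) ∧
    (∀ x ∈ S, ∃ y ∈ S, (x, y) ∈ R) ∧
    (∀ y ∈ S, ∃ x ∈ S, (x, y) ∈ R) ∧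
    (∀ p ∈ R, ∀ q ∈ R, |dk k p.1 q.1 - d p.2 q.2| < ε)

/-- `−Δu = f` on `Ω` in the sense of distributions. -/
def DistribLaplaceEq (Ω : Set ℂ) (u f : ℂ → ℝ) : Prop :=
  ∀ φ : ℂ → ℝ, ContDiff ℝ (⊤ : ℕ∞) φ → HasCompactSupport φ → tsupport φ ⊆ Ω →
    -∫ x in Ω, u x * lap φ x = ∫ x in Ω, f x * φ x


lemma confLen_lower {v : ℂ → ℝ} (hv : Continuous v) {M : ℝ} (hM : ∀ x, |v x| ≤ M) {x y : ℂ} {γ : ℝ → ℂ}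
    (hγ : γ ∈ PathsIn Set.univ x y) : Real.exp (-M) * ‖y - x‖ ≤ confLen v γ := by
  obtain ⟨h0, h1, -, hc⟩ := hγ
  have hd : Continuous (deriv γ) := hc.continuous_deriv le_rfl
  have hFTC : ∫ t in (0:ℝ)..1, deriv γ t = y - x := by
    rw [intervalIntegral.integral_deriv_eq_sub, h0, h1]
    · intro t _; exact (hc.differentiable one_ne_zero) t
    · exact hd.intervalIntegrable _ _
  rw [← hFTC]
  calc _ ≤ Real.exp (-M) * ∫ t in (0:ℝ)..1, ‖deriv γ t‖ := by
        gcongr; exact intervalIntegral.norm_integral_le_integral_norm zero_le_one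
    _ = ∫ t in (0:ℝ)..1, Real.exp (-M) * ‖deriv γ t‖ := by
        rw [intervalIntegral.integral_const_mul]
    _ ≤ _ := by
        apply intervalIntegral.integral_mono_on zero_le_one
        · exact (continuous_const.mul hd.norm).intervalIntegrable _ _
        · exact ((Real.continuous_exp.comp (hv.comp hc.continuous)).mul hd.norm).intervalIntegrable _ _
        · intro t _
          gcongr
          linarith [(abs_le.1 (hM (γ t))).1]

lemma confDist_lower {v : ℂ → ℝ} (hv : Continuous v) {M : ℝ} (hM : ∀ x, |v x| ≤ M) (x y : ℂ) :
    Real.exp (-M) * ‖y - x‖ ≤ confDist v Set.univ x y := by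
  apply le_csInf
  · refine Set.Nonempty.image _ ⟨fun t => x + t • (y - x), by simp, by simp, by simp, ?_⟩
    fun_prop
  · rintro _ ⟨γ, hγ, rfl⟩
    exact confLen_lower hv hM hγ

lemma confDist_upper {v : ℂ → ℝ} (hv : Continuous v) {M : ℝ} (hM : ∀ x, |v x| ≤ M) (x y : ℂ) :
    confDist v Set.univ x y ≤ Real.exp M * ‖y - x‖ := by
  have hmem : (fun t : ℝ => x + t • (y - x)) ∈ PathsIn Set.univ x y := by
    refine ⟨by simp, by simp, by simp, ?_⟩
    fun_prop
  have hder : ∀ t : ℝ, deriv (fun t : ℝ => x + t • (y - x)) t = y - x := by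
    intro t
    have : HasDerivAt (fun t : ℝ => x + t • (y - x)) ((1:ℝ) • (y - x)) t :=
      ((hasDerivAt_id t).smul_const (y - x)).const_add x
    simpa using this.deriv
  refine (csInf_le ?_ (Set.mem_image_of_mem _ hmem)).trans ?_
  · refine ⟨0, ?_⟩
    rintro _ ⟨γ, hγ, rfl⟩
    exact le_trans (by positivity) (confLen_lower hv hM hγ)
  · unfold confLen
    simp only [hder]
    calc _ ≤ ∫ t in (0:ℝ)..1, Real.exp M * ‖y - x‖ := by
          apply intervalIntegral.integral_mono_on zero_le_one
          · apply Continuous.intervalIntegrable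
            fun_prop
          · exact continuous_const.intervalIntegrable _ _
          · intro t _
            gcongr
            exact (abs_le.1 (hM _)).2
      _ = _ := by simp

lemma complete_of_bdd {v : ℂ → ℝ} (hv : Continuous v) {M : ℝ} (hM : ∀ x, |v x| ≤ M) :
    ConfComplete v := by
  intro x hx
  have hc : CauchySeq x := by
    rw [Metric.cauchySeq_iff]
    intro ε hε
    obtain ⟨N, hN⟩ := hx (Real.exp (-M) * ε) (by positivity)
    refine ⟨N, fun m hm n hn => ?_⟩
    have := (confDist_lower hv hM (x m) (x n)).trans_lt (hN m hm n hn)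
    rw [dist_comm, dist_eq_norm]
    exact lt_of_mul_lt_mul_left this (Real.exp_pos _).le
  obtain ⟨l, hl⟩ := cauchySeq_tendsto_of_complete hc
  refine ⟨l, squeeze_zero (fun n => le_trans (by positivity) (confDist_lower hv hM _ _))
    (fun n => confDist_upper hv hM _ _) ?_⟩
  have : Tendsto (fun n => Real.exp M * ‖l - x n‖) atTop (𝓝 (Real.exp M * ‖l - l‖)) :=
    ((tendsto_const_nhds.sub hl).norm).const_mul _
  simpa using this

lemma lap_eq (u : ℂ → ℝ) (x : ℂ) : lap u x =
    fderiv ℝ (fderiv ℝ u) x 1 1 + fderiv ℝ (fderiv ℝ u) x Complex.I Complex.I := by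
  simp [lap, iteratedFDeriv_two_apply]

lemma lap_mul_bound {η u : ℂ → ℝ} {x : ℂ} (hη : ContDiffAt ℝ 2 η x) (hu : ContDiffAt ℝ 2 u x) :
    |lap (fun y => η y * u y) x| ≤ |η x| * |lap u x| + |u x| * |lap η x|
      + 4 * (‖fderiv ℝ η x‖ * ‖fderiv ℝ u x‖) := by
  have h1 : fderiv ℝ (fun y => η y * u y) =ᶠ[𝓝 x]
      fun y => η y • fderiv ℝ u y + u y • fderiv ℝ η y := by
    filter_upwards [hη.eventually (by simp), hu.eventually (by simp)] with y h h'
    exact fderiv_fun_mul (h.differentiableAt (by simp)) (h'.differentiableAt (by simp))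
  have dη := hη.differentiableAt (by simp)
  have du := hu.differentiableAt (by simp)
  have ddη : DifferentiableAt ℝ (fderiv ℝ η) x :=
    (hη.fderiv_right (m := 1) (by norm_num)).differentiableAt (by simp)
  have ddu : DifferentiableAt ℝ (fderiv ℝ u) x :=
    (hu.fderiv_right (m := 1) (by norm_num)).differentiableAt (by simp)
  have h2 : lap (fun y => η y * u y) x = η x * lap u x + u x * lap η x
      + 2 * (fderiv ℝ η x 1 * fderiv ℝ u x 1 + fderiv ℝ η x Complex.I * fderiv ℝ u x Complex.I) := by
    simp only [lap_eq]
    rw [h1.fderiv_eq, fderiv_fun_add (dη.fun_smul ddu) (du.fun_smul ddη), fderiv_fun_smul dη ddu,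
      fderiv_fun_smul du ddη]
    simp
    ring
  have hb : ∀ z : ℂ, ‖z‖ = 1 → |fderiv ℝ η x z * fderiv ℝ u x z| ≤ ‖fderiv ℝ η x‖ * ‖fderiv ℝ u x‖ := by
    intro z hz
    rw [abs_mul]
    have a := (fderiv ℝ η x).le_opNorm z
    have b := (fderiv ℝ u x).le_opNorm z
    rw [hz, mul_one, Real.norm_eq_abs] at a b
    gcongr
  have e1 := hb 1 (by simp)
  have e2 := hb Complex.I (by simp)
  rw [h2, ← abs_mul, ← abs_mul]
  refine (abs_add_three _ _ _).trans ?_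
  gcongr
  rw [abs_mul, abs_two]
  have := abs_add_le (fderiv ℝ η x 1 * fderiv ℝ u x 1) (fderiv ℝ η x Complex.I * fderiv ℝ u x Complex.I)
  linarith

lemma curvIntE_eq (v : ℂ → ℝ) : curvIntE v Set.univ = ∫⁻ x, ENNReal.ofReal |lap v x| := by
  unfold curvIntE gauss
  rw [Measure.restrict_univ]
  congr 1; ext x
  rw [abs_mul, abs_neg, abs_of_pos (Real.exp_pos _), mul_right_comm, ← Real.exp_add]
  simp

/-- unit vector at angle `θ` -/
def eθ (θ : ℝ) : ℂ := Complex.cos θ + Complex.sin θ * Complex.I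

lemma eθ_norm (θ : ℝ) : ‖eθ θ‖ = 1 := by
  unfold eθ
  rw [← Complex.exp_mul_I, Complex.norm_exp_ofReal_mul_I]

lemma eθ_hasDerivAt (θ : ℝ) : HasDerivAt eθ (Complex.I * eθ θ) θ := by
  have h : HasDerivAt (fun t : ℝ => Complex.exp (t * Complex.I))
      (Complex.exp (θ * Complex.I) * (1 * Complex.I)) θ :=
    ((Complex.ofRealCLM.hasDerivAt (x := θ)).mul_const Complex.I).cexp
  have e : eθ = fun t : ℝ => Complex.exp (t * Complex.I) := by
    ext t; simp [eθ, Complex.exp_mul_I]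
  rw [e]
  convert h using 1
  ring

lemma eθ_cont : Continuous eθ := by
  unfold eθ; fun_prop

lemma polar_integrable {G : ℝ × ℝ → ℂ} (hG : Continuous G) {R : ℝ}
    (h0 : ∀ p : ℝ × ℝ, R < p.1 → G p = 0) :
    IntegrableOn G (Set.Ioi 0 ×ˢ Set.Ioo (-Real.pi) Real.pi) (volume.prod volume) := by
  have h1 : IntegrableOn G (Set.Icc 0 R ×ˢ Set.Icc (-Real.pi) Real.pi) (volume.prod volume) :=
    hG.continuousOn.integrableOn_compact (isCompact_Icc.prod isCompact_Icc)
  refine h1.of_forall_sdiff_eq_zero (measurableSet_Ioi.prod measurableSet_Ioo) ?_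
  rintro p ⟨⟨hp1, hp2⟩, hp3⟩
  apply h0
  by_contra hR
  exact hp3 ⟨⟨le_of_lt hp1, not_lt.1 hR⟩, ⟨hp2.1.le, hp2.2.le⟩⟩

lemma pompeiu {w : ℂ → ℂ} (hw : ContDiff ℝ 1 w) (hs : HasCompactSupport w) (x : ℂ) :
    ∫ y, (fderiv ℝ w (x + y) 1 + Complex.I * fderiv ℝ w (x + y) Complex.I) / y
      = - (2 * Real.pi) * w x := by
  have hD : Continuous (fderiv ℝ w) := hw.continuous_fderiv one_ne_zero
  obtain ⟨R, hR⟩ : ∃ R : ℝ, ∀ y : ℂ, R < ‖y‖ → fderiv ℝ w (x + y) = 0 := by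
    obtain ⟨R, hR⟩ := (hs.fderiv (𝕜 := ℝ)).isCompact.isBounded.subset_closedBall x
    refine ⟨R, fun y hy => ?_⟩
    by_contra hne
    have := hR (subset_tsupport _ hne)
    simp at this
    linarith
  rw [← Complex.integral_comp_polarCoord_symm]
  have hpt : polarCoord.target = Set.Ioi (0:ℝ) ×ˢ Set.Ioo (-Real.pi) Real.pi := rfl
  have hR' : ∀ p : ℝ × ℝ, max R 0 < p.1 → fderiv ℝ w (x + p.1 * eθ p.2) = 0 := by
    intro p hp
    apply hR
    rw [norm_mul, eθ_norm, mul_one, Complex.norm_real, Real.norm_eq_abs]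
    exact (le_max_left _ _).trans_lt (hp.trans_le (le_abs_self _))
  set G1 : ℝ × ℝ → ℂ := fun p => fderiv ℝ w (x + p.1 * eθ p.2) (eθ p.2) with hG1
  set G2 : ℝ × ℝ → ℂ := fun p => Complex.I * fderiv ℝ w (x + p.1 * eθ p.2) (Complex.I * eθ p.2) with hG2
  have harg : Continuous fun p : ℝ × ℝ => x + p.1 * eθ p.2 := by
    have := eθ_cont
    fun_prop
  have c1 : Continuous G1 := (hD.comp harg).clm_apply (eθ_cont.comp continuous_snd)
  have c2 : Continuous G2 := continuous_const.mul
    ((hD.comp harg).clm_apply (continuous_const.mul (eθ_cont.comp continuous_snd)))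
  have i1 := polar_integrable c1 (R := max R 0) (by intro p hp; simp [hG1, hR' p hp])
  have i2 := polar_integrable c2 (R := max R 0) (by intro p hp; simp [hG2, hR' p hp])
  have key : ∀ p ∈ Set.Ioi (0:ℝ) ×ˢ Set.Ioo (-Real.pi) Real.pi,
      p.1 • ((fderiv ℝ w (x + Complex.polarCoord.symm p) 1
        + Complex.I * fderiv ℝ w (x + Complex.polarCoord.symm p) Complex.I) / Complex.polarCoord.symm p)
      = G1 p + G2 p := by
    rintro p ⟨hp, -⟩
    have hp' : (p.1 : ℂ) ≠ 0 := by exact_mod_cast (ne_of_gt hp)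
    have he : Complex.polarCoord.symm p = p.1 * eθ p.2 := by
      simp [Complex.polarCoord_symm_apply, eθ]
    have hne : eθ p.2 ≠ 0 := by
      intro h; have := eθ_norm p.2; simp [h] at this
    rw [he]
    simp only [hG1, hG2]
    set L := fderiv ℝ w (x + p.1 * eθ p.2)
    have hL : ∀ z : ℂ, L z = z.re * L 1 + z.im * L Complex.I := by
      intro z
      have : z = z.re • (1:ℂ) + z.im • Complex.I := by
        simp [Complex.re_add_im]
      conv_lhs => rw [this]
      rw [map_add, map_smul, map_smul]
      simp
    rw [hL (eθ p.2), hL (Complex.I * eθ p.2)]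
    have e1 : (eθ p.2) = Real.cos p.2 + Real.sin p.2 * Complex.I := by simp [eθ]
    have hre : (eθ p.2).re = Real.cos p.2 := by rw [e1]; simp [-Complex.ofReal_cos, -Complex.ofReal_sin]
    have him : (eθ p.2).im = Real.sin p.2 := by rw [e1]; simp [-Complex.ofReal_cos, -Complex.ofReal_sin]
    have hsq : (Real.cos p.2 : ℂ)^2 + (Real.sin p.2:ℂ)^2 = 1 := by
      exact_mod_cast Real.cos_sq_add_sin_sq p.2
    rw [Complex.real_smul, mul_div_assoc', mul_div_mul_left _ _ hp', div_eq_iff hne]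
    simp only [Complex.mul_re, Complex.mul_im, Complex.I_re, Complex.I_im, hre, him]
    rw [e1]
    push_cast at hsq ⊢
    generalize Complex.cos p.2 = c at *
    generalize Complex.sin p.2 = s at *
    generalize L 1 = A
    generalize L Complex.I = B
    have hI := Complex.I_sq
    linear_combination (-A - Complex.I * B) * hsq + (s^2 * A - c * s * B + 0) * hI
  have hm : MeasurableSet (Set.Ioi (0:ℝ) ×ˢ Set.Ioo (-Real.pi) Real.pi) :=
    measurableSet_Ioi.prod measurableSet_Ioo
  rw [hpt, setIntegral_congr_fun hm key, Measure.volume_eq_prod, integral_add i1 i2]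
  have I2 : ∫ p in Set.Ioi (0:ℝ) ×ˢ Set.Ioo (-Real.pi) Real.pi, G2 p ∂(volume.prod volume) = 0 := by
    rw [setIntegral_prod _ i2]
    apply integral_eq_zero_of_ae
    filter_upwards [ae_restrict_mem measurableSet_Ioi] with r hr
    have hr' : (r : ℂ) ≠ 0 := by exact_mod_cast (ne_of_gt hr)
    have hd : ∀ θ : ℝ, HasDerivAt (fun θ : ℝ => w (x + r * eθ θ))
        (fderiv ℝ w (x + r * eθ θ) (r * (Complex.I * eθ θ))) θ := by
      intro θ
      exact ((hw.differentiable one_ne_zero) _).hasFDerivAt.comp_hasDerivAt θ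
        (((eθ_hasDerivAt θ).const_mul (r:ℂ)).const_add x)
    have hG : ∀ θ : ℝ, G2 (r, θ) = Complex.I / r * (fderiv ℝ w (x + r * eθ θ) (r * (Complex.I * eθ θ))) := by
      intro θ
      simp only [hG2]
      have h3 : ((r:ℂ) * (Complex.I * eθ θ)) = r • (Complex.I * eθ θ) := by rw [Complex.real_smul]
      rw [h3, map_smul, Complex.real_smul]
      field_simp
    simp only [hG, Pi.zero_apply]
    rw [integral_const_mul, ← integral_Ioc_eq_integral_Ioo, ← intervalIntegral.integral_of_le (by linarith [Real.pi_pos]),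
      intervalIntegral.integral_eq_sub_of_hasDerivAt (fun θ _ => hd θ)]
    · simp [eθ]
    · apply Continuous.intervalIntegrable
      have h1 : Continuous fun θ : ℝ => x + r * eθ θ := by
        have := eθ_cont
        fun_prop
      exact (hD.comp h1).clm_apply (continuous_const.mul (continuous_const.mul eθ_cont))
  have I1 : ∫ p in Set.Ioi (0:ℝ) ×ˢ Set.Ioo (-Real.pi) Real.pi, G1 p ∂(volume.prod volume)
      = -(2 * Real.pi) * w x := by
    rw [← Measure.prod_restrict, integral_prod_symm]
    swap
    · rw [Measure.prod_restrict]; exact i1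
    have : ∀ θ : ℝ, ∫ r in Set.Ioi (0:ℝ), G1 (r, θ) = - w x := by
      intro θ
      have hd : ∀ r : ℝ, HasDerivAt (fun r : ℝ => w (x + r * eθ θ))
          (fderiv ℝ w (x + r * eθ θ) (eθ θ)) r := by
        intro r
        have h0 : HasDerivAt (fun r : ℝ => x + r * eθ θ) (1 * eθ θ) r :=
          ((Complex.ofRealCLM.hasDerivAt (x := r)).mul_const (eθ θ)).const_add x
        rw [one_mul] at h0
        exact ((hw.differentiable one_ne_zero) _).hasFDerivAt.comp_hasDerivAt r h0
      have hcd : ContDiff ℝ 1 (fun r : ℝ => w (x + r * eθ θ)) := by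
        apply hw.comp
        exact contDiff_const.add ((Complex.ofRealCLM.contDiff).mul contDiff_const)
      have hcs : HasCompactSupport (fun r : ℝ => w (x + r * eθ θ)) := by
        apply hs.comp_isClosedEmbedding (g := fun r : ℝ => x + r * eθ θ)
        apply Isometry.isClosedEmbedding
        apply Isometry.of_dist_eq
        intro a b
        rw [dist_add_left, dist_eq_norm, ← sub_mul, norm_mul, eθ_norm, mul_one, ← Complex.ofReal_sub,
          Complex.norm_real, dist_eq_norm]
      have := hcs.integral_Ioi_deriv_eq hcd 0
      simpa [(hd _).deriv] using this
    simp only [this]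
    simp [Real.pi_pos.le]
    ring_nf
    simp
  rw [I1, I2, add_zero]

lemma pompeiu_bound {w : ℂ → ℂ} (hw : ContDiff ℝ 1 w) (hs : HasCompactSupport w) (x : ℂ) :
    ENNReal.ofReal (2 * Real.pi) * ‖w x‖ₑ ≤
      ∫⁻ y, ‖fderiv ℝ w y 1 + Complex.I * fderiv ℝ w y Complex.I‖ₑ * ‖y - x‖ₑ⁻¹ := by
  have h := enorm_integral_le_lintegral_enorm (μ := volume) fun y : ℂ =>
    (fderiv ℝ w (x + y) 1 + Complex.I * fderiv ℝ w (x + y) Complex.I) / y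
  rw [pompeiu hw hs x, enorm_mul] at h
  have h2 : ‖(-(2 * Real.pi) : ℂ)‖ₑ = ENNReal.ofReal (2 * Real.pi) := by
    rw [← ofReal_norm]
    congr 1
    simp [abs_of_pos Real.pi_pos]
  rw [h2] at h
  refine h.trans ?_
  rw [← lintegral_add_left_eq_self (μ := volume) (fun y => ‖fderiv ℝ w y 1 + Complex.I * fderiv ℝ w y Complex.I‖ₑ * ‖y - x‖ₑ⁻¹) x]
  apply lintegral_mono
  intro y
  by_cases hy : y = 0
  · simp [hy]
  · simp only [add_sub_cancel_left]
    rw [div_eq_mul_inv, enorm_mul, enorm_inv hy]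

lemma kernel_ball (r : ℝ) (hr : 0 < r) :
    ∫⁻ x in ball (0:ℂ) r, ‖x‖ₑ⁻¹ ≤ ENNReal.ofReal (2 * Real.pi * r) := by
  rw [← lintegral_indicator measurableSet_ball, ← Complex.lintegral_comp_polarCoord_symm]
  calc _ ≤ ∫⁻ p in (Set.Ioi (0:ℝ) ×ˢ Set.Ioo (-Real.pi) Real.pi),
        (Set.Ioo (0:ℝ) r ×ˢ (Set.Ioo (-Real.pi) Real.pi)).indicator (fun _ => (1:ℝ≥0∞)) p := by
        apply setLIntegral_mono' (measurableSet_Ioi.prod measurableSet_Ioo)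
        rintro p ⟨hp, hp2⟩
        have hp0 : 0 < p.1 := hp
        have he : Complex.polarCoord.symm p = p.1 * eθ p.2 := by
          simp [Complex.polarCoord_symm_apply, eθ]
        have hn : ‖Complex.polarCoord.symm p‖ = p.1 := by
          rw [he, norm_mul, eθ_norm, mul_one, Complex.norm_real, Real.norm_eq_abs, abs_of_pos hp]
        by_cases h : p.1 < r
        · have hmem : p ∈ Set.Ioo (0:ℝ) r ×ˢ Set.Ioo (-Real.pi) Real.pi := ⟨⟨hp, h⟩, hp2⟩
          rw [Set.indicator_of_mem (mem_ball_zero_iff.2 (hn.trans_lt h)), Set.indicator_of_mem hmem,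
            ← ofReal_norm, hn, smul_eq_mul, ENNReal.mul_inv_cancel]
          · simpa using hp0
          · simp
        · rw [Set.indicator_of_notMem (by rw [mem_ball_zero_iff, hn]; exact h)]
          simp
    _ ≤ ∫⁻ p, (Set.Ioo (0:ℝ) r ×ˢ (Set.Ioo (-Real.pi) Real.pi)).indicator (fun _ => (1:ℝ≥0∞)) p :=
        setLIntegral_le_lintegral _ _
    _ = _ := by
        rw [lintegral_indicator (measurableSet_Ioo.prod measurableSet_Ioo)]
        simp only [lintegral_const, one_mul, Measure.restrict_apply_univ]
        rw [Measure.volume_eq_prod, Measure.prod_prod, Real.volume_Ioo, Real.volume_Ioo,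
          ← ENNReal.ofReal_mul (by linarith)]
        congr 1; ring

lemma kernel_set (E : Set ℂ) (y : ℂ) (r : ℝ) (hr : 0 < r) :
    ∫⁻ x in E, ‖y - x‖ₑ⁻¹ ≤ ENNReal.ofReal (2 * Real.pi * r) + ENNReal.ofReal r⁻¹ * volume E := by
  calc _ ≤ ∫⁻ x in E, ((ball y r).indicator (fun x => ‖y - x‖ₑ⁻¹) x + ENNReal.ofReal r⁻¹) := by
        apply lintegral_mono
        intro x
        by_cases h : x ∈ ball y r
        · simp only [Set.indicator_of_mem h]; exact le_self_add
        · simp only [Set.indicator_of_notMem h, zero_add]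
          rw [ENNReal.ofReal_inv_of_pos hr, ENNReal.inv_le_inv, ← ofReal_norm]
          apply ENNReal.ofReal_le_ofReal
          rw [mem_ball, not_lt, dist_comm, dist_eq_norm] at h
          exact h
    _ = (∫⁻ x in E, (ball y r).indicator (fun x => ‖y - x‖ₑ⁻¹) x) + ENNReal.ofReal r⁻¹ * volume E := by
        rw [lintegral_add_right _ measurable_const]
        simp
    _ ≤ _ := by
        gcongr
        refine (setLIntegral_le_lintegral _ _).trans ?_
        refine le_trans (le_of_eq ?_) (kernel_ball r hr)
        rw [← lintegral_indicator measurableSet_ball, ← lintegral_sub_left_eq_self (μ := volume) _ y]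
        congr 1; ext x
        by_cases h : ‖x‖ < r
        · rw [Set.indicator_of_mem (by simpa using h), Set.indicator_of_mem (by simpa using h)]
          simp
        · rw [Set.indicator_of_notMem (by simpa using h), Set.indicator_of_notMem (by simpa using h)]

lemma grad_bound {v : ℂ → ℝ} (hv : ContDiff ℝ 2 v) (hs : HasCompactSupport v) (x : ℂ) :
    ENNReal.ofReal (2 * Real.pi) * ‖fderiv ℝ v x‖ₑ ≤
      ∫⁻ y, ENNReal.ofReal |lap v y| * ‖y - x‖ₑ⁻¹ := by
  have hDv : ContDiff ℝ 1 (fderiv ℝ v) := hv.fderiv_right (by norm_num)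
  set w : ℂ → ℂ := fun y => (fderiv ℝ v y 1 : ℂ) - Complex.I * (fderiv ℝ v y Complex.I : ℂ) with hwdef
  have ha : ∀ z : ℂ, ContDiff ℝ 1 fun y => (fderiv ℝ v y z : ℂ) := fun z =>
    Complex.ofRealCLM.contDiff.comp (hDv.clm_apply contDiff_const)
  have hw : ContDiff ℝ 1 w := (ha 1).sub (contDiff_const.mul (ha Complex.I))
  have hws : HasCompactSupport w := by
    refine (hs.fderiv (𝕜 := ℝ)).mono fun y hy => ?_
    intro h0
    apply hy
    simp [hwdef, h0]
  have hda : ∀ (z y : ℂ), HasFDerivAt (fun y => (fderiv ℝ v y z : ℂ))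
      (Complex.ofRealCLM.comp ((ContinuousLinearMap.apply ℝ ℝ z).comp (fderiv ℝ (fderiv ℝ v) y))) y := by
    intro z y
    have h1 : HasFDerivAt (fderiv ℝ v) (fderiv ℝ (fderiv ℝ v) y) y :=
      ((hDv.differentiable one_ne_zero) y).hasFDerivAt
    exact Complex.ofRealCLM.hasFDerivAt.comp y ((ContinuousLinearMap.apply ℝ ℝ z).hasFDerivAt.comp y h1)
  have hdw : ∀ y, fderiv ℝ w y 1 + Complex.I * fderiv ℝ w y Complex.I = (lap v y : ℂ) := by
    intro y
    have h := ((hda 1 y).sub ((hda Complex.I y).const_mul Complex.I)).fderiv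
    have h' : fderiv ℝ w y = _ := h
    have hsym : fderiv ℝ (fderiv ℝ v) y 1 Complex.I = fderiv ℝ (fderiv ℝ v) y Complex.I 1 :=
      (hv.contDiffAt.isSymmSndFDerivAt (by simp)) 1 Complex.I
    rw [h', lap_eq]
    simp [hsym]
    linear_combination (-((fderiv ℝ (fderiv ℝ v) y Complex.I Complex.I : ℝ) : ℂ)) * Complex.I_sq
  have hb := pompeiu_bound hw hws x
  simp only [hdw] at hb
  have hn : ‖fderiv ℝ v x‖ ≤ ‖w x‖ := by
    apply ContinuousLinearMap.opNorm_le_bound _ (norm_nonneg _)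
    intro z
    have h1 : fderiv ℝ v x z = (w x * z).re := by
      have : z = z.re • (1:ℂ) + z.im • Complex.I := by
        simp [Complex.re_add_im]
      conv_lhs => rw [this]
      rw [map_add, map_smul, map_smul]
      simp [hwdef]
      ring
    rw [h1, ← norm_mul, Real.norm_eq_abs]
    exact Complex.abs_re_le_norm _
  calc _ ≤ ENNReal.ofReal (2 * Real.pi) * ‖w x‖ₑ := by
        gcongr
        rw [← ofReal_norm, ← ofReal_norm]
        exact ENNReal.ofReal_le_ofReal hn
    _ ≤ _ := hb
    _ = _ := by
        congr 1; ext y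
        rw [← ofReal_norm (lap v y : ℂ), Complex.norm_real, Real.norm_eq_abs]

lemma lap_cont {v : ℂ → ℝ} (hv : ContDiff ℝ 2 v) : Continuous (lap v) := by
  have h2 : Continuous (fderiv ℝ (fderiv ℝ v)) :=
    (hv.fderiv_right (m := 1) (by norm_num)).continuous_fderiv one_ne_zero
  have : lap v = fun x => fderiv ℝ (fderiv ℝ v) x 1 1 + fderiv ℝ (fderiv ℝ v) x Complex.I Complex.I :=
    funext (lap_eq v)
  rw [this]
  fun_prop

lemma weak_bound {v : ℂ → ℝ} (hv : ContDiff ℝ 2 v) (hs : HasCompactSupport v) {A : ℝ} (hA : 0 ≤ A)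
    (hlap : ∫⁻ y, ENNReal.ofReal |lap v y| ≤ ENNReal.ofReal A) {E : Set ℂ} (hE : MeasurableSet E)
    (hfin : volume E ≠ ⊤) {t : ℝ} (ht : 0 < t) (hEt : ∀ x ∈ E, t ≤ ‖fderiv ℝ v x‖) :
    t * (volume E).toReal ^ ((1:ℝ)/2) ≤ 2 * A := by
  set m := (volume E).toReal with hm
  have hvol : volume E = ENNReal.ofReal m := (ENNReal.ofReal_toReal hfin).symm
  have hm0 : 0 ≤ m := ENNReal.toReal_nonneg
  rw [← Real.sqrt_eq_rpow]
  rcases hm0.eq_or_lt with h0 | hpos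
  · rw [← h0]; simp; exact hA
  set s := Real.sqrt m
  have hspos : 0 < s := Real.sqrt_pos.2 hpos
  have hss : s * s = m := Real.mul_self_sqrt hm0
  have hlc := lap_cont hv
  have main : ENNReal.ofReal (2 * Real.pi * (t * m)) ≤ ENNReal.ofReal (A * ((2 * Real.pi + 1) * s)) := by
    calc ENNReal.ofReal (2 * Real.pi * (t * m))
        = ∫⁻ x in E, ENNReal.ofReal (2 * Real.pi) * ENNReal.ofReal t := by
          rw [setLIntegral_const, hvol, ← ENNReal.ofReal_mul (by positivity),
            ← ENNReal.ofReal_mul (by positivity)]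
          congr 1; ring
      _ ≤ ∫⁻ x in E, ∫⁻ y, ENNReal.ofReal |lap v y| * ‖y - x‖ₑ⁻¹ := by
          apply setLIntegral_mono' hE
          intro x hx
          refine le_trans ?_ (grad_bound hv hs x)
          gcongr
          rw [← ofReal_norm]
          exact ENNReal.ofReal_le_ofReal (hEt x hx)
      _ = ∫⁻ y, ∫⁻ x in E, ENNReal.ofReal |lap v y| * ‖y - x‖ₑ⁻¹ := by
          apply lintegral_lintegral_swap
          apply Measurable.aemeasurable
          have := hlc.measurable
          simp only [Function.uncurry_def]
          fun_prop
      _ = ∫⁻ y, ENNReal.ofReal |lap v y| * ∫⁻ x in E, ‖y - x‖ₑ⁻¹ := by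
          congr 1; ext y
          rw [lintegral_const_mul]
          fun_prop
      _ ≤ ∫⁻ y, ENNReal.ofReal |lap v y| * ENNReal.ofReal ((2 * Real.pi + 1) * s) := by
          gcongr with y
          refine (kernel_set E y s hspos).trans (le_of_eq ?_)
          rw [hvol, ← ENNReal.ofReal_mul (by positivity), ← ENNReal.ofReal_add (by positivity) (by positivity)]
          congr 1
          rw [← hss]; field_simp
      _ = (∫⁻ y, ENNReal.ofReal |lap v y|) * ENNReal.ofReal ((2 * Real.pi + 1) * s) := by
          rw [lintegral_mul_const]
          have := hlc.measurable
          fun_prop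
      _ ≤ ENNReal.ofReal A * ENNReal.ofReal ((2 * Real.pi + 1) * s) := by gcongr
      _ = _ := (ENNReal.ofReal_mul hA).symm
  have h2 := (ENNReal.ofReal_le_ofReal_iff (by positivity)).1 main
  rw [← hss] at h2
  have h3 : 2 * Real.pi * (t * s) ≤ A * (2 * Real.pi + 1) := by
    apply le_of_mul_le_mul_right _ hspos
    linarith
  have hpi := Real.pi_gt_three
  by_contra hcon
  push Not at hcon
  nlinarith

lemma cutoff_exists : ∃ (η : ℂ → ℝ) (M : ℝ), 0 ≤ M ∧ ContDiff ℝ (⊤ : ℕ∞) η ∧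
    (∀ x ∈ ball (0:ℂ) (1/2), η x = 1) ∧ (∀ x, |η x| ≤ 1) ∧
    (∀ x, x ∉ ball (0:ℂ) (3/4) → η x = 0) ∧ (∀ x, ‖fderiv ℝ η x‖ ≤ M) ∧ (∀ x, |lap η x| ≤ M) := by
  let f : ContDiffBump (0:ℂ) := ⟨1/2, 3/4, by norm_num, by norm_num⟩
  have hf : ContDiff ℝ (⊤ : ℕ∞) f := f.contDiff
  have hf2 : ContDiff ℝ 2 f := f.contDiff
  have hs : HasCompactSupport f := f.hasCompactSupport
  obtain ⟨M1, h1⟩ := (hf2.continuous_fderiv (by simp)).bounded_above_of_compact_support (hs.fderiv (𝕜 := ℝ))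
  have hls : HasCompactSupport (lap f) := by
    refine ((hs.fderiv (𝕜 := ℝ)).fderiv (𝕜 := ℝ)).mono fun y hy h0 => hy ?_
    rw [lap_eq, h0]; simp
  obtain ⟨M2, h2⟩ := (lap_cont hf2).bounded_above_of_compact_support hls
  refine ⟨f, max M1 M2, ?_, hf, ?_, ?_, ?_, fun x => (h1 x).trans (le_max_left _ _),
    fun x => (h2 x).trans (le_max_right _ _)⟩
  · exact (norm_nonneg _).trans ((h1 0).trans (le_max_left _ _))
  · intro x hx
    exact f.one_of_mem_closedBall (ball_subset_closedBall hx)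
  · intro x
    rw [abs_of_nonneg f.nonneg]; exact f.le_one
  · intro x hx
    apply f.zero_of_le_dist
    simpa using hx


/-- a conformal factor with `‖u‖_{W^{1,1}(D)} + ‖Δu‖_{L¹(D)} < Λ₃` gives a
metric on `D_{1/2}` extendable to a complete metric on `ℂ` with `‖K‖_{L¹} < C(Λ₃)`, and
`‖∇u‖_{L^{2,∞}(D_{1/2})} < C(Λ₃)`. -/
theorem statement12 (Λ₃ : ℝ) (hΛ₃ : 0 < Λ₃) :
    ∃ C : ℝ, 0 < C ∧
      ∀ u : ℂ → ℝ, ContDiffOn ℝ (⊤ : ℕ∞) u (ball (0:ℂ) 1) →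
        IntegrableOn u (ball (0:ℂ) 1) volume →
        IntegrableOn (fun x => ‖fderiv ℝ u x‖) (ball (0:ℂ) 1) volume →
        IntegrableOn (fun x => lap u x) (ball (0:ℂ) 1) volume →
        (∫ x in ball (0:ℂ) 1, |u x|) + (∫ x in ball (0:ℂ) 1, ‖fderiv ℝ u x‖)
            + (∫ x in ball (0:ℂ) 1, |lap u x|) < Λ₃ →
        (∃ v : ℂ → ℝ, ContDiff ℝ (⊤ : ℕ∞) v ∧ Set.EqOn v u (ball (0:ℂ) (1/2)) ∧
            ConfComplete v ∧ curvIntE v Set.univ < ENNReal.ofReal C) ∧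
          wL2Bound (fun x => ‖fderiv ℝ u x‖) (ball (0:ℂ) (1/2)) C := by
  obtain ⟨η, M, hM, hη, hη1, hηle, hη0, hηd, hηl⟩ := cutoff_exists
  set A : ℝ := (1 + 4 * M) * Λ₃ with hA
  have hApos : 0 < A := by positivity
  refine ⟨2 * A, by positivity, ?_⟩
  intro u hu iu idu ilu hsum
  set v : ℂ → ℝ := fun x => η x * u x with hvdef
  have hv0 : ∀ x, x ∉ ball (0:ℂ) (3/4) → v x = 0 := fun x hx => by simp [hvdef, hη0 x hx]
  have hts : tsupport v ⊆ closedBall (0:ℂ) (3/4) := by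
    apply closure_minimal _ isClosed_closedBall
    intro x hx
    by_contra h
    exact hx (hv0 x fun h' => h (ball_subset_closedBall h'))
  have hvs : HasCompactSupport v := HasCompactSupport.of_support_subset_isCompact
    (isCompact_closedBall (0:ℂ) (3/4)) ((subset_tsupport v).trans hts)
  have huAt : ∀ x ∈ ball (0:ℂ) 1, ContDiffAt ℝ (⊤ : ℕ∞) u x := fun x hx =>
    hu.contDiffAt (isOpen_ball.mem_nhds hx)
  have hv : ContDiff ℝ (⊤ : ℕ∞) v := by
    rw [contDiff_iff_contDiffAt]
    intro x
    by_cases hx : x ∈ ball (0:ℂ) 1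
    · exact hη.contDiffAt.mul (huAt x hx)
    · have hx' : x ∉ tsupport v := fun h => by
        have := hts h
        simp at this hx
        linarith
      have : v =ᶠ[𝓝 x] fun _ => 0 := notMem_tsupport_iff_eventuallyEq.1 hx'
      exact contDiffAt_const.congr_of_eventuallyEq this
  have hv2 : ContDiff ℝ 2 v := hv.of_le (WithTop.coe_le_coe.2 (le_top : (2 : ℕ∞) ≤ ⊤))
  have hvu : Set.EqOn v u (ball (0:ℂ) (1/2)) := fun x hx => by simp [hvdef, hη1 x hx]
  have hlap0 : ∀ x, x ∉ ball (0:ℂ) 1 → lap v x = 0 := by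
    intro x hx
    have hx' : x ∉ tsupport v := fun h => by
      have := hts h
      simp at this hx
      linarith
    have h1 : x ∉ tsupport (fderiv ℝ v) := fun h => hx' (tsupport_fderiv_subset ℝ h)
    have h2 : x ∉ tsupport (fderiv ℝ (fderiv ℝ v)) := fun h => h1 (tsupport_fderiv_subset ℝ h)
    rw [lap_eq, image_eq_zero_of_notMem_tsupport h2]
    simp
  have hlapb : ∀ x ∈ ball (0:ℂ) 1, |lap v x| ≤ |lap u x| + M * |u x| + 4 * M * ‖fderiv ℝ u x‖ := by
    intro x hx
    have h2 : ContDiffAt ℝ 2 u x := (huAt x hx).of_le (WithTop.coe_le_coe.2 (le_top : (2 : ℕ∞) ≤ ⊤))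
    have h3 : ContDiffAt ℝ 2 η x := hη.contDiffAt.of_le (WithTop.coe_le_coe.2 (le_top : (2 : ℕ∞) ≤ ⊤))
    refine (lap_mul_bound h3 h2).trans ?_
    have e1 : |η x| * |lap u x| ≤ |lap u x| := mul_le_of_le_one_left (abs_nonneg _) (hηle x)
    have e2 : |u x| * |lap η x| ≤ M * |u x| := by
      rw [mul_comm]; exact mul_le_mul_of_nonneg_right (hηl x) (abs_nonneg _)
    have e3 : ‖fderiv ℝ η x‖ * ‖fderiv ℝ u x‖ ≤ M * ‖fderiv ℝ u x‖ :=
      mul_le_mul_of_nonneg_right (hηd x) (norm_nonneg _)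
    linarith
  have hL1 : ∫⁻ y, ENNReal.ofReal |lap v y| ≤ ENNReal.ofReal A := by
    have hsub : ∫⁻ y, ENNReal.ofReal |lap v y| = ∫⁻ y in ball (0:ℂ) 1, ENNReal.ofReal |lap v y| := by
      rw [← lintegral_indicator measurableSet_ball]
      congr 1; ext y
      by_cases hy : y ∈ ball (0:ℂ) 1
      · rw [Set.indicator_of_mem hy]
      · rw [Set.indicator_of_notMem hy, hlap0 y hy]; simp
    have i1 : IntegrableOn (fun x => |lap u x| + M * |u x|) (ball (0:ℂ) 1) :=
      Integrable.add ilu.abs (iu.abs.const_mul M)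
    have i3 : IntegrableOn (fun x => 4 * M * ‖fderiv ℝ u x‖) (ball (0:ℂ) 1) :=
      Integrable.const_mul idu (4 * M)
    have i2 : IntegrableOn (fun x => |lap u x| + M * |u x| + 4 * M * ‖fderiv ℝ u x‖) (ball (0:ℂ) 1) :=
      Integrable.add i1 i3
    rw [hsub]
    calc _ ≤ ∫⁻ y in ball (0:ℂ) 1, ENNReal.ofReal (|lap u y| + M * |u y| + 4 * M * ‖fderiv ℝ u y‖) := by
          apply setLIntegral_mono' measurableSet_ball
          intro x hx
          exact ENNReal.ofReal_le_ofReal (hlapb x hx)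
      _ = ENNReal.ofReal (∫ y in ball (0:ℂ) 1, (|lap u y| + M * |u y| + 4 * M * ‖fderiv ℝ u y‖)) := by
          rw [ofReal_integral_eq_lintegral_ofReal i2]
          exact Eventually.of_forall fun x => by
            simp only [Pi.zero_apply]; positivity
      _ ≤ _ := by
          apply ENNReal.ofReal_le_ofReal
          rw [integral_add i1 i3, integral_add ilu.abs (iu.abs.const_mul M), integral_const_mul,
            integral_const_mul]
          have p1 : 0 ≤ ∫ x in ball (0:ℂ) 1, |u x| := integral_nonneg fun x => abs_nonneg _
          have p2 : 0 ≤ ∫ x in ball (0:ℂ) 1, ‖fderiv ℝ u x‖ := integral_nonneg fun x => norm_nonneg _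
          have p3 : 0 ≤ ∫ x in ball (0:ℂ) 1, |lap u x| := integral_nonneg fun x => abs_nonneg _
          rw [hA]
          nlinarith [mul_nonneg hM p1, mul_nonneg hM p2, mul_nonneg hM p3, mul_le_mul_of_nonneg_left hsum.le hM]
  refine ⟨⟨v, hv, hvu, ?_, ?_⟩, ?_⟩
  · obtain ⟨B, hB⟩ := hv.continuous.bounded_above_of_compact_support hvs
    exact complete_of_bdd hv.continuous (M := B) hB
  · rw [curvIntE_eq]
    refine hL1.trans_lt ?_
    rw [ENNReal.ofReal_lt_ofReal_iff (by positivity)]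
    linarith
  · intro t ht
    have hcv : Continuous (fderiv ℝ v) := hv2.continuous_fderiv (by simp)
    have hset : {x ∈ ball (0:ℂ) (1/2) | t < |‖fderiv ℝ u x‖|}
        = ball (0:ℂ) (1/2) ∩ {x | t < ‖fderiv ℝ v x‖} := by
      ext x
      simp only [Set.mem_ofPred_eq, Set.mem_inter_iff, abs_norm]
      refine and_congr_right fun hx => ?_
      have : fderiv ℝ v x = fderiv ℝ u x :=
        (hvu.eventuallyEq_of_mem (isOpen_ball.mem_nhds hx)).fderiv_eq
      rw [this]
    rw [hset]
    apply weak_bound hv2 hvs hApos.le hL1 _ _ ht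
    · intro x hx; exact hx.2.le
    · exact measurableSet_ball.inter (isOpen_lt continuous_const hcv.norm).measurableSet
    · exact ((measure_mono Set.inter_subset_left).trans_lt measure_ball_lt_top).ne
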